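/- arXiv:0812.1036 — 2 statements merged into one kernel-verified Lean document; each statement's English description precedes it below -/
import Mathlib

section
/- For every real α ∈ (1, 2) and every ε > 0 there exist integers t and d with d ≥ 2 and t² > 4d such that, setting λ = (t + √(t² − 4d))/2 and μ = (t − √(t² − 4d))/2, one has λ > 1 > μ > 0, λ·μ = d, both λ and μ are roots of the characteristic polynomial of the integer matrix [[t, −d], [1, 0]] regarded as a real 2×2 matrix, and |(2 + (ln μ)/(ln λ)) − α| < ε. -/
/-- For `0 < β < 1`, some natural number `n > 2` has both `n ^ β` and `n / n ^ β` at least `2`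
and `log n` as large as desired. -/
theorem exists_nat_large (β : ℝ) (h0 : 0 < β) (h1 : β < 1) (C : ℝ) :
    ∃ n : ℕ, (2 : ℝ) < n ∧ 2 ≤ (n : ℝ) ^ β ∧ 2 * (n : ℝ) ^ β ≤ n ∧ C < Real.log n := by
  have hcast := tendsto_natCast_atTop_atTop (R := ℝ)
  have e1 := hcast.eventually_gt_atTop 2
  have e2 := ((tendsto_rpow_atTop h0).comp hcast).eventually_ge_atTop 2
  have e3 := ((tendsto_rpow_atTop (sub_pos.mpr h1)).comp hcast).eventually_ge_atTop 2
  have e4 := (Real.tendsto_log_atTop.comp hcast).eventually_gt_atTop C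
  obtain ⟨n, a1, a2, a3, a4⟩ := (e1.and (e2.and (e3.and e4))).exists
  simp only [Function.comp_apply] at a2 a3 a4
  have hn0 : (0 : ℝ) < n := by linarith
  refine ⟨n, a1, a2, ?_, a4⟩
  calc 2 * (n : ℝ) ^ β ≤ (n : ℝ) ^ (1 - β) * (n : ℝ) ^ β := by gcongr
    _ = n := by rw [← Real.rpow_add hn0]; simp

theorem log_mem_Icc_of_half_le {x y : ℝ} (hx : 0 < x) (hxy : x / 2 ≤ y) (hyx : y ≤ x) :
    Real.log y ∈ Set.Icc (Real.log x - Real.log 2) (Real.log x) := by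
  refine ⟨?_, Real.log_le_log (by linarith) hyx⟩
  rw [← Real.log_div hx.ne' two_ne_zero]
  exact Real.log_le_log (by linarith) hxy

/-- Density proposition: for every `α ∈ (1,2)` and `ε > 0` there are integers `t, d`
with `d ≥ 2`, `t² > 4d`, whose companion matrix `[[t, −d], [1, 0]]` has real
eigenvalues `λ > 1 > μ > 0` with `λμ = d` and `|(2 + log_λ μ) − α| < ε`. -/
theorem stmt_2 (α : ℝ) (hα : α ∈ Set.Ioo (1 : ℝ) 2) (ε : ℝ) (hε : 0 < ε) :
    ∃ t d : ℤ, 2 ≤ d ∧ 4 * d < t ^ 2 ∧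
      ((t : ℝ) + Real.sqrt ((t : ℝ) ^ 2 - 4 * d)) / 2 > 1 ∧
      (1 : ℝ) > ((t : ℝ) - Real.sqrt ((t : ℝ) ^ 2 - 4 * d)) / 2 ∧
      ((t : ℝ) - Real.sqrt ((t : ℝ) ^ 2 - 4 * d)) / 2 > 0 ∧
      (((t : ℝ) + Real.sqrt ((t : ℝ) ^ 2 - 4 * d)) / 2) *
        (((t : ℝ) - Real.sqrt ((t : ℝ) ^ 2 - 4 * d)) / 2) = (d : ℝ) ∧
      (Matrix.charpoly (!![(t : ℝ), -(d : ℝ); 1, 0])).IsRoot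
        (((t : ℝ) + Real.sqrt ((t : ℝ) ^ 2 - 4 * d)) / 2) ∧
      (Matrix.charpoly (!![(t : ℝ), -(d : ℝ); 1, 0])).IsRoot
        (((t : ℝ) - Real.sqrt ((t : ℝ) ^ 2 - 4 * d)) / 2) ∧
      |(2 + Real.log (((t : ℝ) - Real.sqrt ((t : ℝ) ^ 2 - 4 * d)) / 2) /
            Real.log (((t : ℝ) + Real.sqrt ((t : ℝ) ^ 2 - 4 * d)) / 2)) - α| < ε := by
  obtain ⟨h1, h2⟩ := hα
  obtain ⟨n, hn2, hnlow, hnhigh, hnlog⟩ := exists_nat_large (α - 1) (by linarith) (by linarith)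
    (Real.log 2 + 2 * Real.log 2 / ε)
  have hn0 : (0 : ℝ) < n := by linarith
  set X : ℝ := (n : ℝ) ^ (α - 1) with hX
  have hdle : ((⌊X⌋ : ℤ) : ℝ) ≤ X := Int.floor_le X
  have hdgt : X - 1 < ((⌊X⌋ : ℤ) : ℝ) := Int.sub_one_lt_floor X
  have hd2 : (2 : ℤ) ≤ ⌊X⌋ := Int.le_floor.mpr (by exact_mod_cast hnlow)
  have hd2r : (2 : ℝ) ≤ ((⌊X⌋ : ℤ) : ℝ) := by exact_mod_cast hd2
  have hlogX : Real.log X = (α - 1) * Real.log n := Real.log_rpow hn0 _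
  refine ⟨n, ⌊X⌋, hd2, ?_⟩
  generalize ⌊X⌋ = d at hdle hdgt hd2 hd2r ⊢
  have hdisc : 4 * (d : ℝ) < (n : ℝ) ^ 2 := by nlinarith
  refine ⟨by exact_mod_cast hdisc, ?_⟩
  push_cast
  have hsq : √((n : ℝ) ^ 2 - 4 * d) ^ 2 = (n : ℝ) ^ 2 - 4 * d := Real.sq_sqrt (by linarith)
  have hs0 : 0 ≤ √((n : ℝ) ^ 2 - 4 * d) := Real.sqrt_nonneg _
  generalize √((n : ℝ) ^ 2 - 4 * d) = s at hsq hs0 ⊢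
  have hsn : s < n := by nlinarith
  have hns : (n : ℝ) - 2 < s := by nlinarith
  have hmul : ((n : ℝ) + s) / 2 * (((n : ℝ) - s) / 2) = d := by linarith
  refine ⟨by linarith, by linarith, by linarith, hmul, ?_, ?_, ?_⟩
  · simp [Matrix.charpoly_fin_two, Matrix.det_fin_two, Matrix.trace_fin_two]
    linarith
  · simp [Matrix.charpoly_fin_two, Matrix.det_fin_two, Matrix.trace_fin_two]
    linarith
  · have hlam : 0 < ((n : ℝ) + s) / 2 := by linarith
    have hmu : 0 < ((n : ℝ) - s) / 2 := by linarith
    have hlogd : Real.log d = Real.log (((n : ℝ) + s) / 2) + Real.log (((n : ℝ) - s) / 2) := by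
      rw [← hmul, Real.log_mul hlam.ne' hmu.ne']
    obtain ⟨hl1, hl2⟩ := log_mem_Icc_of_half_le hn0 (y := ((n : ℝ) + s) / 2)
      (by linarith) (by linarith)
    obtain ⟨hd1, hd2⟩ := log_mem_Icc_of_half_le (by linarith : 0 < X) (y := (d : ℝ))
      (by linarith) hdle
    rw [hlogX] at hd1 hd2
    have hlog2 : 0 < Real.log 2 := Real.log_pos one_lt_two
    have hq : 0 < 2 * Real.log 2 / ε := by positivity
    generalize Real.log (((n : ℝ) + s) / 2) = l at *
    generalize Real.log (((n : ℝ) - s) / 2) = m at *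
    have hl : 0 < l := by linarith
    have hbig : 2 * Real.log 2 < l * ε := (div_lt_iff₀ hε).mp (by linarith)
    have hrw : 2 + m / l - α = (l + m - (α - 1) * l) / l := by field_simp; ring
    rw [hrw, abs_div, abs_of_pos hl, div_lt_iff₀ hl, abs_lt]
    constructor <;> nlinarith
end

section
/- The set of real numbers of the form 2 + (ln μ)/(ln λ), where λ = (t + √(t² − 4d))/2 and μ = (t − √(t² − 4d))/2 for integers t, d satisfying 2 ≤ d ≤ t − 4, is dense in the open interval (1, 2). -/
open Filter Topology

/-- A sequence within a factor two of `n ^ a` has logarithmic growth exponent `a`. -/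
theorem tendsto_log_div_log_of_rpow_bounds {f : ℕ → ℝ} {a : ℝ}
    (hl : ∀ᶠ n : ℕ in atTop, (n : ℝ) ^ a / 2 ≤ f n)
    (hu : ∀ᶠ n : ℕ in atTop, f n ≤ (n : ℝ) ^ a) :
    Tendsto (fun n : ℕ => Real.log (f n) / Real.log n) atTop (𝓝 a) := by
  have hlog : Tendsto (fun n : ℕ => Real.log n) atTop atTop :=
    Real.tendsto_log_atTop.comp tendsto_natCast_atTop_atTop
  have hlow : Tendsto (fun n : ℕ => a - Real.log 2 / Real.log n) atTop (𝓝 a) := by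
    simpa using (hlog.const_div_atTop (Real.log 2)).const_sub a
  refine tendsto_of_tendsto_of_tendsto_of_le_of_le' hlow tendsto_const_nhds ?_ ?_
  · filter_upwards [hl, hlog.eventually_gt_atTop 0, eventually_gt_atTop 0] with n h hn h0
    have hn0 : (0 : ℝ) < n := by exact_mod_cast h0
    have hp : (0 : ℝ) < (n : ℝ) ^ a := Real.rpow_pos_of_pos hn0 a
    have h1 := Real.log_le_log (by positivity) h
    rw [Real.log_div hp.ne' two_ne_zero, Real.log_rpow hn0] at h1
    rw [le_div_iff₀ hn, sub_mul, div_mul_cancel₀ _ hn.ne']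
    exact h1
  · filter_upwards [hl, hu, hlog.eventually_gt_atTop 0, eventually_gt_atTop 0] with n h h' hn h0
    have hn0 : (0 : ℝ) < n := by exact_mod_cast h0
    have hp : (0 : ℝ) < (n : ℝ) ^ a := Real.rpow_pos_of_pos hn0 a
    have h1 := Real.log_le_log (by linarith) h'
    rw [Real.log_rpow hn0] at h1
    rwa [div_le_iff₀ hn]

theorem two_add_log_div_log_eigenvalues {t d : ℝ} (hd : 0 < d) (ht : 2 < t)
    (hdt : 4 * d ≤ t ^ 2) :
    2 + Real.log ((t - √(t ^ 2 - 4 * d)) / 2) / Real.log ((t + √(t ^ 2 - 4 * d)) / 2) =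
      1 + Real.log d / Real.log ((t + √(t ^ 2 - 4 * d)) / 2) := by
  have hs := Real.sqrt_nonneg (t ^ 2 - 4 * d)
  have hsq := Real.sq_sqrt (sub_nonneg.2 hdt)
  set s := √(t ^ 2 - 4 * d)
  have hlam : 1 < (t + s) / 2 := by linarith
  have hlog := Real.log_pos hlam
  have hmu : (t - s) / 2 = d / ((t + s) / 2) := by
    rw [eq_div_iff (by linarith)]
    linarith
  rw [hmu, Real.log_div hd.ne' (by linarith), sub_div, div_self hlog.ne']
  ring

/-- The set of numbers `2 + log_λ μ`, with `λ, μ` the eigenvalues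
`(t ± √(t² − 4d))/2` for integers `2 ≤ d ≤ t − 4`, is dense in `(1, 2)`. -/
theorem stmt_3 :
    Set.Ioo (1 : ℝ) 2 ⊆
      closure { x : ℝ | ∃ t d : ℤ, 2 ≤ d ∧ d ≤ t - 4 ∧
        x = 2 + Real.log (((t : ℝ) - Real.sqrt ((t : ℝ) ^ 2 - 4 * d)) / 2) /
              Real.log (((t : ℝ) + Real.sqrt ((t : ℝ) ^ 2 - 4 * d)) / 2) } := by
  rintro y ⟨hy1, hy2⟩
  obtain ⟨a, rfl⟩ : ∃ a, y = 1 + a := ⟨y - 1, by ring⟩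
  have ha0 : 0 < a := by linarith
  have ha1 : a < 1 := by linarith
  let d : ℕ → ℤ := fun n => ⌊(n : ℝ) ^ a⌋
  let lam : ℕ → ℝ := fun n => ((n : ℝ) + √((n : ℝ) ^ 2 - 4 * d n)) / 2
  have hfl : ∀ n, (d n : ℝ) ≤ (n : ℝ) ^ a := fun n => Int.floor_le _
  have hlarge : ∀ᶠ n : ℕ in atTop, (2 : ℝ) ≤ (n : ℝ) ^ a :=
    ((tendsto_rpow_atTop ha0).comp tendsto_natCast_atTop_atTop).eventually_ge_atTop 2
  have hd2 : ∀ᶠ n in atTop, 2 ≤ d n := by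
    filter_upwards [hlarge] with n hn
    exact Int.le_floor.2 (by exact_mod_cast hn)
  have hdn : ∀ᶠ n : ℕ in atTop, d n ≤ (n : ℤ) - 4 := by
    have hgap : ∀ᶠ n : ℕ in atTop, (2 : ℝ) ≤ (n : ℝ) ^ (1 - a) :=
      ((tendsto_rpow_atTop (sub_pos.2 ha1)).comp
        tendsto_natCast_atTop_atTop).eventually_ge_atTop 2
    filter_upwards [hgap, eventually_ge_atTop 8] with n hn h8
    have h8' : (8 : ℝ) ≤ n := by exact_mod_cast h8
    have hmul : (n : ℝ) ^ a * (n : ℝ) ^ (1 - a) = n := by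
      rw [← Real.rpow_add (by linarith), add_sub_cancel, Real.rpow_one]
    have h1 := mul_le_mul_of_nonneg_left hn (Real.rpow_nonneg n.cast_nonneg a)
    have h2 : (d n : ℝ) ≤ (n : ℝ) - 4 := by linarith [hfl n]
    exact_mod_cast h2
  have hlogd : Tendsto (fun n : ℕ => Real.log (d n) / Real.log n) atTop (𝓝 a) := by
    refine tendsto_log_div_log_of_rpow_bounds ?_ (Eventually.of_forall hfl)
    filter_upwards [hlarge] with n hn
    linarith [Int.sub_one_lt_floor ((n : ℝ) ^ a)]
  have hloglam : Tendsto (fun n : ℕ => Real.log (lam n) / Real.log n) atTop (𝓝 1) := by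
    refine tendsto_log_div_log_of_rpow_bounds ?_ ?_
    · refine Eventually.of_forall fun n => ?_
      simp only [Real.rpow_one, lam]
      linarith [Real.sqrt_nonneg ((n : ℝ) ^ 2 - 4 * d n)]
    · filter_upwards [hd2] with n hn
      have hn' : (2 : ℝ) ≤ d n := by exact_mod_cast hn
      have : √((n : ℝ) ^ 2 - 4 * d n) ≤ n :=
        Real.sqrt_le_iff.2 ⟨n.cast_nonneg, by linarith⟩
      simp only [Real.rpow_one, lam]
      linarith
  have hlim : Tendsto (fun n => 1 + Real.log (d n) / Real.log (lam n)) atTop (𝓝 (1 + a)) := by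
    have h := (hlogd.div hloglam one_ne_zero).const_add 1
    rw [div_one] at h
    refine h.congr' ?_
    filter_upwards [eventually_gt_atTop 1] with n hn
    have : Real.log n ≠ 0 := (Real.log_pos (by exact_mod_cast hn)).ne'
    rw [Pi.div_apply, div_div_div_cancel_right₀ this]
  refine mem_closure_of_tendsto hlim ?_
  filter_upwards [hd2, hdn] with n h2 h4
  refine ⟨n, d n, h2, h4, ?_⟩
  have h2' : (2 : ℝ) ≤ d n := by exact_mod_cast h2
  have h4' : (d n : ℝ) ≤ n - 4 := by exact_mod_cast h4
  rw [Int.cast_natCast, two_add_log_div_log_eigenvalues (by linarith) (by linarith)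
    (by nlinarith [sq_nonneg ((n : ℝ) - 2)])]
end
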